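/- Converse (rate) part of the rate-distortion-equivocation theorem with side information at the user: every (n, M) code whose average distortion satisfies Δ ≤ D and whose equivocation satisfies Δ_p ≥ E has rate (1/n) log₂ M ≥ R(D, E). -/

import Mathlib

open scoped BigOperators
open Classical

noncomputable section

/-- A probability mass function on a finite type: a nonnegative function summing to 1. -/
def IsPMF {α : Type} [Fintype α] (q : α → ℝ) : Prop :=
  (∀ a, 0 ≤ q a) ∧ ∑ a, q a = 1

/-- A conditional pmf (channel) from `α` to `β`. -/
def IsKernel {α β : Type} [Fintype β] (k : α → β → ℝ) : Prop :=
  ∀ a, (∀ b, 0 ≤ k a b) ∧ ∑ b, k a b = 1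

/-- Pushforward distribution of a pmf `μ` along a map `f`. -/
def pushf {Ω α : Type} [Fintype Ω] (μ : Ω → ℝ) (f : Ω → α) : α → ℝ :=
  fun a => ∑ ω, if f ω = a then μ ω else 0

/-- Shannon entropy (base 2) of a pmf; the convention `0 · log 0 = 0` is automatic
since `Real.logb 2 0 = 0` in Mathlib. -/
def ent {α : Type} [Fintype α] (q : α → ℝ) : ℝ :=
  -∑ a, q a * Real.logb 2 (q a)

/-- Entropy of the random variable `f` under the pmf `μ`. -/
def Hof {Ω α : Type} [Fintype Ω] [Fintype α] (μ : Ω → ℝ) (f : Ω → α) : ℝ :=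
  ent (pushf μ f)

/-- Conditional Shannon entropy `H(f | g)` under `μ`. -/
def condH {Ω α β : Type} [Fintype Ω] [Fintype α] [Fintype β]
    (μ : Ω → ℝ) (f : Ω → α) (g : Ω → β) : ℝ :=
  Hof μ (fun ω => (f ω, g ω)) - Hof μ g

/-- Shannon mutual information `I(f ; g)` under `μ`. -/
def mutI {Ω α β : Type} [Fintype Ω] [Fintype α] [Fintype β]
    (μ : Ω → ℝ) (f : Ω → α) (g : Ω → β) : ℝ :=
  Hof μ f + Hof μ g - Hof μ (fun ω => (f ω, g ω))

/-- Expectation of `h` under the pmf `μ`. -/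
def expect {Ω : Type} [Fintype Ω] (μ : Ω → ℝ) (h : Ω → ℝ) : ℝ :=
  ∑ ω, μ ω * h ω

/-- The i.i.d. product pmf of `n` copies of `p`. -/
def iidPMF {α : Type} [Fintype α] (p : α → ℝ) (n : ℕ) : (Fin n → α) → ℝ :=
  fun x => ∏ i, p (x i)


/-- Joint pmf of `((X_r, X_h, Z), U)` obtained from the source pmf `p` and a conditional
pmf `pu = p(u | x_r, x_h)`; the Markov chain `U — (X_r, X_h) — Z` is built in. -/
def jointU {Xr Xh Z U : Type} (p : Xr × Xh × Z → ℝ) (pu : Xr × Xh → U → ℝ) :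
    (Xr × Xh × Z) × U → ℝ :=
  fun su => p su.1 * pu (su.1.1, su.1.2.1) su.2

/-- The set of equivocations `H(X_h | U, Z)` over all finite `U`, conditional pmfs
`p(u | x_r, x_h)` and functions `g : U × Z → X̂` with `E[d(X_r, g(U, Z))] ≤ D`. -/
def GammaSet {Xr Xh Z Xhat : Type} [Fintype Xr] [Fintype Xh] [Fintype Z] [Fintype Xhat]
    (p : Xr × Xh × Z → ℝ) (d : Xr → Xhat → ℝ) (D : ℝ) : Set ℝ :=
  { e | ∃ (U : Type) (_ : Fintype U) (pu : Xr × Xh → U → ℝ) (g : U × Z → Xhat),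
      IsKernel pu ∧
      expect (jointU p pu) (fun su => d su.1.1 (g (su.2, su.1.2.2))) ≤ D ∧
      e = condH (jointU p pu) (fun su => su.1.2.1) (fun su => (su.2, su.1.2.2)) }

/-- `Γ(D)`, the maximal achievable equivocation at distortion `D`. -/
def Gamma {Xr Xh Z Xhat : Type} [Fintype Xr] [Fintype Xh] [Fintype Z] [Fintype Xhat]
    (p : Xr × Xh × Z → ℝ) (d : Xr → Xhat → ℝ) (D : ℝ) : ℝ :=
  sSup (GammaSet p d D)

/-- The reconstruction `X̂ⁿ` produced by an `(n, M)` code from the source realization. -/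
def recon {Xr Xh Z Xhat : Type} {n M : ℕ}
    (FE : (Fin n → Xr × Xh) → Fin M) (FD : Fin M × (Fin n → Z) → Fin n → Xhat)
    (x : Fin n → Xr × Xh × Z) : Fin n → Xhat :=
  FD (FE (fun i => ((x i).1, (x i).2.1)), fun i => (x i).2.2)

/-- Average per-letter distortion `Δ` of an `(n, M)` code. -/
def avgDist {Xr Xh Z Xhat : Type} [Fintype Xr] [Fintype Xh] [Fintype Z] [Fintype Xhat]
    (p : Xr × Xh × Z → ℝ) (d : Xr → Xhat → ℝ) {n M : ℕ}
    (FE : (Fin n → Xr × Xh) → Fin M) (FD : Fin M × (Fin n → Z) → Fin n → Xhat) : ℝ :=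
  (1 / (n : ℝ)) * expect (iidPMF p n) (fun x => ∑ i, d ((x i).1) (recon FE FD x i))

/-- Equivocation `Δ_p = (1/n) H(X_hⁿ | W, Zⁿ)` of an `(n, M)` code. -/
def equivoc {Xr Xh Z Xhat : Type} [Fintype Xr] [Fintype Xh] [Fintype Z] [Fintype Xhat]
    (p : Xr × Xh × Z → ℝ) {n M : ℕ}
    (FE : (Fin n → Xr × Xh) → Fin M) (_FD : Fin M × (Fin n → Z) → Fin n → Xhat) : ℝ :=
  (1 / (n : ℝ)) * condH (iidPMF p n)
      (fun x => fun i => (x i).2.1)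
      (fun x => (FE (fun i => ((x i).1, (x i).2.1)), fun i => (x i).2.2))

/-- The set of objective values `I(X_r, X_h; U) − I(Z; U)` over all finite `U`, conditional
pmfs `p(u | x_r, x_h)` and `g : U × Z → X̂` with `E[d(X_r, g(U, Z))] ≤ D` and
`H(X_h | U, Z) ≥ E`. -/
def RDESet {Xr Xh Z Xhat : Type} [Fintype Xr] [Fintype Xh] [Fintype Z] [Fintype Xhat]
    (p : Xr × Xh × Z → ℝ) (d : Xr → Xhat → ℝ) (D E : ℝ) : Set ℝ :=
  { r | ∃ (U : Type) (_ : Fintype U) (pu : Xr × Xh → U → ℝ) (g : U × Z → Xhat),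
      IsKernel pu ∧
      expect (jointU p pu) (fun su => d su.1.1 (g (su.2, su.1.2.2))) ≤ D ∧
      condH (jointU p pu) (fun su => su.1.2.1) (fun su => (su.2, su.1.2.2)) ≥ E ∧
      r = mutI (jointU p pu) (fun su => (su.1.1, su.1.2.1)) (fun su => su.2)
            - mutI (jointU p pu) (fun su => su.1.2.2) (fun su => su.2) }

/-- The rate-distortion-equivocation function `R(D, E)`. -/
def RDE {Xr Xh Z Xhat : Type} [Fintype Xr] [Fintype Xh] [Fintype Z] [Fintype Xhat]
    (p : Xr × Xh × Z → ℝ) (d : Xr → Xhat → ℝ) (D E : ℝ) : ℝ :=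
  sInf (RDESet p d D E)

/-! ### Pushforwards, expectations and entropies on finite probability spaces -/

theorem pushf_nonneg {Ω α : Type} [Fintype Ω] {μ : Ω → ℝ} (hμ : ∀ ω, 0 ≤ μ ω)
    (f : Ω → α) (a : α) : 0 ≤ pushf μ f a :=
  Finset.sum_nonneg fun ω _ => by split_ifs <;> simp [hμ]

theorem le_pushf_apply {Ω α : Type} [Fintype Ω] {μ : Ω → ℝ} (hμ : ∀ ω, 0 ≤ μ ω)
    (f : Ω → α) (ω : Ω) : μ ω ≤ pushf μ f (f ω) := by
  have h := Finset.single_le_sum (f := fun ω' => if f ω' = f ω then μ ω' else 0)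
    (fun ω' _ => by split_ifs <;> simp [hμ]) (Finset.mem_univ ω)
  simpa [pushf] using h

theorem expect_pushf {Ω α : Type} [Fintype Ω] [Fintype α] (μ : Ω → ℝ) (f : Ω → α)
    (h : α → ℝ) : expect (pushf μ f) h = expect μ (fun ω => h (f ω)) := by
  simp only [expect, pushf, Finset.sum_mul, ite_mul, zero_mul]
  rw [Finset.sum_comm]
  simp

theorem sum_pushf {Ω α : Type} [Fintype Ω] [Fintype α] (μ : Ω → ℝ) (f : Ω → α) :
    ∑ a, pushf μ f a = ∑ ω, μ ω := by
  simpa [expect] using expect_pushf μ f (fun _ => 1)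

theorem IsPMF.pushf {Ω α : Type} [Fintype Ω] [Fintype α] {μ : Ω → ℝ} (hμ : IsPMF μ)
    (f : Ω → α) : IsPMF (pushf μ f) :=
  ⟨pushf_nonneg hμ.1 f, (sum_pushf μ f).trans hμ.2⟩

theorem pushf_pushf {Ω α β : Type} [Fintype Ω] [Fintype α] (μ : Ω → ℝ) (f : Ω → α)
    (g : α → β) : pushf (pushf μ f) g = pushf μ (fun ω => g (f ω)) := by
  funext b
  have h := expect_pushf μ f (fun a => if g a = b then 1 else 0)
  simpa [expect, pushf] using h

theorem pushf_id {Ω : Type} [Fintype Ω] (μ : Ω → ℝ) : pushf μ (fun ω => ω) = μ := by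
  funext ω
  simp [pushf]

theorem Hof_pushf {Ω α β : Type} [Fintype Ω] [Fintype α] [Fintype β] (μ : Ω → ℝ)
    (f : Ω → α) (g : α → β) : Hof (pushf μ f) g = Hof μ (fun ω => g (f ω)) := by
  rw [Hof, pushf_pushf, Hof]

theorem condH_pushf {Ω α β γ : Type} [Fintype Ω] [Fintype α] [Fintype β] [Fintype γ]
    (μ : Ω → ℝ) (f : Ω → α) (g : α → β) (h : α → γ) :
    condH (pushf μ f) g h = condH μ (fun ω => g (f ω)) (fun ω => h (f ω)) := by
  rw [condH, condH, Hof_pushf, Hof_pushf]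

theorem Hof_eq_neg_expect {Ω α : Type} [Fintype Ω] [Fintype α] (μ : Ω → ℝ) (f : Ω → α) :
    Hof μ f = -expect μ (fun ω => Real.logb 2 (pushf μ f (f ω))) := by
  rw [Hof, ent, ← expect_pushf μ f (fun a => Real.logb 2 (pushf μ f a)), expect]

/-- Entropy depends only on the partition generated by the random variable. -/
theorem Hof_congr {Ω α β : Type} [Fintype Ω] [Fintype α] [Fintype β] (μ : Ω → ℝ)
    {f : Ω → α} {g : Ω → β} (h : ∀ ω ω', f ω = f ω' ↔ g ω = g ω') : Hof μ f = Hof μ g := by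
  rw [Hof_eq_neg_expect, Hof_eq_neg_expect]
  simp only [pushf, h]

/-- Gibbs' inequality. -/
theorem ent_le_neg_sum_logb {α : Type} [Fintype α] {q r : α → ℝ} (hq : IsPMF q)
    (hr : ∀ a, 0 ≤ r a) (hr1 : ∑ a, r a ≤ 1) (hqr : ∀ a, 0 < q a → 0 < r a) :
    ent q ≤ -∑ a, q a * Real.logb 2 (r a) := by
  have hlog : (0 : ℝ) < Real.log 2 := Real.log_pos (by norm_num)
  have key : ∀ a, q a * Real.log (r a) - q a * Real.log (q a) ≤ r a - q a := by
    intro a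
    rcases (hq.1 a).eq_or_lt with h | h
    · simp [← h, hr a]
    · have h1 := Real.log_le_sub_one_of_pos (div_pos (hqr a h) h)
      rw [Real.log_div (hqr a h).ne' h.ne'] at h1
      have h2 := mul_le_mul_of_nonneg_left h1 h.le
      have h3 : q a * (r a / q a - 1) = r a - q a := by field_simp
      linarith
  have hsum := Finset.sum_le_sum fun a (_ : a ∈ Finset.univ) => key a
  simp only [Finset.sum_sub_distrib, hq.2] at hsum
  simp only [ent, Real.logb, ← mul_div_assoc, ← Finset.sum_div]
  exact neg_le_neg (div_le_div_of_nonneg_right (by linarith) hlog.le)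

theorem pushf_fst_eq_sum {Ω α β : Type} [Fintype Ω] [Fintype β] (μ : Ω → ℝ)
    (f : Ω → α) (g : Ω → β) (a : α) :
    pushf μ f a = ∑ b, pushf μ (fun ω => (f ω, g ω)) (a, b) := by
  simp only [pushf, Prod.mk.injEq]
  rw [Finset.sum_comm]
  refine Finset.sum_congr rfl fun ω _ => ?_
  by_cases h : f ω = a <;> simp [h]

/-- Submodularity of entropy: conditioning on more reduces entropy. -/
theorem Hof_submodular {Ω α β γ : Type} [Fintype Ω] [Fintype α] [Fintype β] [Fintype γ]
    {μ : Ω → ℝ} (hμ : IsPMF μ) (f : Ω → α) (g : Ω → β) (h : Ω → γ) :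
    Hof μ (fun ω => (f ω, g ω, h ω)) + Hof μ h
      ≤ Hof μ (fun ω => (h ω, f ω)) + Hof μ (fun ω => (h ω, g ω)) := by
  set F := pushf μ (fun ω => (h ω, f ω)) with hF
  set G := pushf μ (fun ω => (h ω, g ω)) with hG
  set K := pushf μ h with hK
  have hF0 : ∀ x, 0 ≤ F x := pushf_nonneg hμ.1 _
  have hG0 : ∀ x, 0 ≤ G x := pushf_nonneg hμ.1 _
  have hK0 : ∀ x, 0 ≤ K x := pushf_nonneg hμ.1 _
  have hpos : ∀ ω, 0 < μ ω → 0 < F (h ω, f ω) ∧ 0 < G (h ω, g ω) ∧ 0 < K (h ω) :=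
    fun ω hω => ⟨hω.trans_le (le_pushf_apply hμ.1 (fun ω => (h ω, f ω)) ω),
      hω.trans_le (le_pushf_apply hμ.1 (fun ω => (h ω, g ω)) ω),
      hω.trans_le (le_pushf_apply hμ.1 h ω)⟩
  have gibbs := ent_le_neg_sum_logb (hμ.pushf (fun ω => (f ω, g ω, h ω)))
    (r := fun x => F (x.2.2, x.1) * G (x.2.2, x.2.1) / K x.2.2)
    (fun x => div_nonneg (mul_nonneg (hF0 _) (hG0 _)) (hK0 _)) ?_ ?_
  · have e := expect_pushf μ (fun ω => (f ω, g ω, h ω))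
      (fun x => Real.logb 2 (F (x.2.2, x.1) * G (x.2.2, x.2.1) / K x.2.2))
    rw [expect] at e
    rw [e] at gibbs
    have split : expect μ (fun ω => Real.logb 2 (F (h ω, f ω) * G (h ω, g ω) / K (h ω)))
        = expect μ (fun ω => Real.logb 2 (F (h ω, f ω)))
          + expect μ (fun ω => Real.logb 2 (G (h ω, g ω)))
          - expect μ (fun ω => Real.logb 2 (K (h ω))) := by
      simp only [expect, ← Finset.sum_add_distrib, ← Finset.sum_sub_distrib]
      refine Finset.sum_congr rfl fun ω _ => ?_
      rcases (hμ.1 ω).eq_or_lt with h0 | h0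
      · simp [← h0]
      · obtain ⟨h1, h2, h3⟩ := hpos ω h0
        rw [Real.logb_div (mul_pos h1 h2).ne' h3.ne', Real.logb_mul h1.ne' h2.ne']
        ring
    rw [Hof_eq_neg_expect μ h, Hof_eq_neg_expect μ (fun ω => (h ω, f ω)),
      Hof_eq_neg_expect μ (fun ω => (h ω, g ω)), Hof]
    linarith
  · calc ∑ x : α × β × γ, F (x.2.2, x.1) * G (x.2.2, x.2.1) / K x.2.2
        = ∑ c, (∑ a, F (c, a)) * (∑ b, G (c, b)) / K c := by
          simp only [Fintype.sum_prod_type, Finset.sum_mul_sum, Finset.sum_div]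
          rw [Finset.sum_comm' (t' := Finset.univ) (s' := fun _ => Finset.univ) (by simp)]
          rw [Finset.sum_congr rfl fun b _ => Finset.sum_comm]
          rw [Finset.sum_comm]
          exact Finset.sum_congr rfl fun c _ => Finset.sum_comm
      _ = ∑ c, K c := by
          refine Finset.sum_congr rfl fun c _ => ?_
          rw [hF, hG, ← pushf_fst_eq_sum, ← pushf_fst_eq_sum, mul_self_div_self]
      _ ≤ 1 := ((sum_pushf μ h).trans hμ.2).le
  · rintro ⟨a, b, c⟩ hx
    obtain ⟨ω, -, hω⟩ := Finset.exists_ne_zero_of_sum_ne_zero hx.ne'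
    have hω' : (f ω, g ω, h ω) = (a, b, c) ∧ μ ω ≠ 0 := by simpa [and_assoc] using hω
    obtain ⟨h1, h2, h3⟩ := hpos ω ((hμ.1 ω).lt_of_ne' hω'.2)
    simp only [Prod.mk.injEq] at hω'
    obtain ⟨⟨rfl, rfl, rfl⟩, -⟩ := hω'
    exact div_pos (mul_pos h1 h2) h3

theorem condH_le_logb_card {Ω α β : Type} [Fintype Ω] [Fintype α] [Fintype β]
    {μ : Ω → ℝ} (hμ : IsPMF μ) (f : Ω → α) (g : Ω → β) :
    condH μ f g ≤ Real.logb 2 (Fintype.card α) := by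
  have hne : Nonempty Ω := by
    by_contra hcon
    have := not_nonempty_iff.1 hcon
    simpa using hμ.2
  have hα : (0 : ℝ) < Fintype.card α :=
    Nat.cast_pos.2 (Fintype.card_pos_iff.2 (hne.map f))
  have gibbs := ent_le_neg_sum_logb (hμ.pushf (fun ω => (f ω, g ω)))
    (r := fun x => pushf μ g x.2 / Fintype.card α)
    (fun x => div_nonneg (pushf_nonneg hμ.1 g _) hα.le) ?_ ?_
  · have e := expect_pushf μ (fun ω => (f ω, g ω))
      (fun x => Real.logb 2 (pushf μ g x.2 / Fintype.card α))
    rw [expect] at e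
    rw [e] at gibbs
    have split : expect μ (fun ω => Real.logb 2 (pushf μ g (g ω) / Fintype.card α))
        = expect μ (fun ω => Real.logb 2 (pushf μ g (g ω))) - Real.logb 2 (Fintype.card α) := by
      rw [← one_mul (Real.logb 2 (Fintype.card α : ℝ)), ← hμ.2]
      simp only [expect, Finset.sum_mul, ← Finset.sum_sub_distrib]
      refine Finset.sum_congr rfl fun ω _ => ?_
      rcases (hμ.1 ω).eq_or_lt with h0 | h0
      · simp [← h0]
      · rw [Real.logb_div (h0.trans_le (le_pushf_apply hμ.1 g ω)).ne' hα.ne']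
        ring
    rw [condH, Hof_eq_neg_expect μ g, Hof]
    linarith
  · rw [Fintype.sum_prod_type]
    simp only [← Finset.sum_div, sum_pushf, hμ.2]
    simp [hα.ne']
  · rintro ⟨a, b⟩ hx
    obtain ⟨ω, -, hω⟩ := Finset.exists_ne_zero_of_sum_ne_zero hx.ne'
    have hω' : (f ω, g ω) = (a, b) ∧ μ ω ≠ 0 := by simpa [and_assoc] using hω
    simp only [Prod.mk.injEq] at hω'
    obtain ⟨⟨rfl, rfl⟩, h0⟩ := hω'
    exact div_pos (((hμ.1 ω).lt_of_ne' h0).trans_le (le_pushf_apply hμ.1 g ω)) hα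

theorem condH_pi_le_sum {Ω α β : Type} [Fintype Ω] [Fintype α] [Fintype β]
    {μ : Ω → ℝ} (hμ : IsPMF μ) (g : Ω → β) {n : ℕ} (f : Ω → Fin n → α) :
    condH μ f g ≤ ∑ i, condH μ (fun ω => f ω i) g := by
  induction n with
  | zero =>
    rw [condH, Hof_congr μ (f := fun ω => (f ω, g ω)) (g := g)
      (fun ω ω' => by simp [Subsingleton.elim (f ω) (f ω')])]
    simp
  | succ n ih =>
    have ih' := ih (fun ω i => f ω i.succ)
    have sub := Hof_submodular hμ (fun ω => f ω 0) (fun ω (i : Fin n) => f ω i.succ) g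
    rw [Hof_congr μ (f := fun ω => (f ω 0, (fun i : Fin n => f ω i.succ), g ω))
      (g := fun ω => (f ω, g ω)) (by simp [funext_iff, Fin.forall_fin_succ, and_assoc]),
      Hof_congr μ (f := fun ω => (g ω, f ω 0)) (g := fun ω => (f ω 0, g ω))
        (by simp [and_comm]),
      Hof_congr μ (f := fun ω => (g ω, fun i : Fin n => f ω i.succ))
        (g := fun ω => (fun i : Fin n => f ω i.succ, g ω)) (by simp [and_comm])] at sub
    rw [Fin.sum_univ_succ]
    simp only [condH] at ih' sub ⊢
    linarith

/-! ### Product distributions -/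

theorem iidPMF_isPMF {α : Type} [Fintype α] {p : α → ℝ} (hp : IsPMF p) (n : ℕ) :
    IsPMF (iidPMF p n) := by
  refine ⟨fun x => Finset.prod_nonneg fun i _ => hp.1 _, ?_⟩
  have h := Finset.prod_univ_sum (fun _ : Fin n => (Finset.univ : Finset α)) (fun _ a => p a)
  simp only [hp.2, Fintype.piFinset_univ] at h
  simpa [iidPMF] using h.symm

/-- Resampling one coordinate of an i.i.d. vector does not change its law. -/
theorem sum_resample {α : Type} [Fintype α] {p : α → ℝ} (hp : IsPMF p) {n : ℕ} (i : Fin n)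
    (F : (Fin n → α) → ℝ) :
    ∑ s, p s * ∑ y, iidPMF p n y * F (Function.update y i s) = ∑ y, iidPMF p n y * F y := by
  have hinv : Function.Involutive
      (fun t : α × (Fin n → α) => (t.2 i, Function.update t.2 i t.1)) := by
    rintro ⟨s, y⟩
    simp
  have h := Equiv.sum_comp hinv.toPerm
    (fun t : α × (Fin n → α) => p t.1 * (iidPMF p n t.2 * F t.2))
  have hw : ∀ s y, p (y i) * iidPMF p n (Function.update y i s) = p s * iidPMF p n y := by
    intro s y
    simp only [iidPMF]
    rw [← Finset.mul_prod_erase _ _ (Finset.mem_univ i),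
      ← Finset.mul_prod_erase _ (fun j => p (y j)) (Finset.mem_univ i)]
    rw [Finset.prod_congr rfl fun j hj => by
      rw [Function.update_of_ne (Finset.ne_of_mem_erase hj)]]
    simp only [Function.update_self]
    ring
  simp only [Function.Involutive.coe_toPerm, Fintype.sum_prod_type, ← mul_assoc, hw] at h
  simp only [mul_assoc, ← Finset.mul_sum, ← Finset.sum_mul, hp.2, one_mul] at h
  exact h

theorem expect_iidPMF_eval {α : Type} [Fintype α] {p : α → ℝ} (hp : IsPMF p) {n : ℕ}
    (i : Fin n) (F : α → ℝ) : expect (iidPMF p n) (fun y => F (y i)) = expect p F := by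
  simp only [expect]
  rw [← sum_resample hp i]
  simp [← Finset.sum_mul, (iidPMF_isPMF hp n).2]

theorem ent_iidPMF {α : Type} [Fintype α] {p : α → ℝ} (hp : IsPMF p) (n : ℕ) :
    ent (iidPMF p n) = n * ent p := by
  have h : ∀ y, iidPMF p n y * Real.logb 2 (iidPMF p n y)
      = ∑ i, iidPMF p n y * Real.logb 2 (p (y i)) := by
    intro y
    by_cases h0 : iidPMF p n y = 0
    · simp [h0]
    · rw [← Finset.mul_sum]
      congr 1
      rw [iidPMF, Real.logb_prod]
      exact Finset.prod_ne_zero_iff.1 h0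
  have hi := fun i : Fin n => expect_iidPMF_eval hp i (fun a => Real.logb 2 (p a))
  simp only [expect] at hi
  simp only [ent, h]
  rw [Finset.sum_comm]
  simp [hi]

theorem pushf_iidPMF {α β : Type} [Fintype α] [Fintype β] (p : α → ℝ) (g : α → β) (n : ℕ) :
    pushf (iidPMF p n) (fun y i => g (y i)) = iidPMF (pushf p g) n := by
  funext z
  simp only [pushf, iidPMF]
  rw [Finset.prod_univ_sum, Fintype.piFinset_univ]
  refine Finset.sum_congr rfl fun y _ => ?_
  rw [Finset.prod_ite_zero]
  simp [funext_iff]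

/-! ### Time sharing -/

/-- The law of a uniform index in `Fin n` together with an independent sample of `μ`. -/
def timeShare {Ω : Type} (n : ℕ) (μ : Ω → ℝ) : Fin n × Ω → ℝ :=
  fun t => (1 / (n : ℝ)) * μ t.2

theorem timeShare_isPMF {Ω : Type} [Fintype Ω] {μ : Ω → ℝ} (hμ : IsPMF μ) {n : ℕ}
    (hn : 0 < n) : IsPMF (timeShare n μ) := by
  refine ⟨fun t => mul_nonneg (by positivity) (hμ.1 _), ?_⟩
  have : (n : ℝ) ≠ 0 := by positivity
  simp [timeShare, Fintype.sum_prod_type, ← Finset.mul_sum, hμ.2, this]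

theorem expect_timeShare {Ω : Type} [Fintype Ω] (μ : Ω → ℝ) (n : ℕ)
    (F : Fin n × Ω → ℝ) :
    expect (timeShare n μ) F = (1 / (n : ℝ)) * ∑ i, expect μ (fun ω => F (i, ω)) := by
  simp [expect, timeShare, Fintype.sum_prod_type, Finset.mul_sum, mul_assoc]

theorem pushf_timeShare {Ω α : Type} [Fintype Ω] (μ : Ω → ℝ) (n : ℕ)
    (f : Fin n → Ω → α) (i : Fin n) (a : α) :
    pushf (timeShare n μ) (fun t => (t.1, f t.1 t.2)) (i, a)
      = (1 / (n : ℝ)) * pushf μ (f i) a := by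
  simp only [pushf, timeShare, Fintype.sum_prod_type, Prod.mk.injEq, Finset.mul_sum]
  rw [Finset.sum_eq_single i]
  · simp
  · intro j _ hj
    simp [hj]
  · simp

theorem Hof_timeShare {Ω α : Type} [Fintype Ω] [Fintype α] {μ : Ω → ℝ} (hμ : IsPMF μ)
    {n : ℕ} (hn : 0 < n) (f : Fin n → Ω → α) :
    Hof (timeShare n μ) (fun t => (t.1, f t.1 t.2))
      = Real.logb 2 n + (1 / (n : ℝ)) * ∑ i, Hof μ (f i) := by
  have hn' : (0 : ℝ) < n := by positivity
  simp only [Hof_eq_neg_expect, expect_timeShare, pushf_timeShare]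
  have h : ∀ i, expect μ (fun ω => Real.logb 2 (1 / (n : ℝ) * pushf μ (f i) (f i ω)))
      = -Real.logb 2 n + expect μ (fun ω => Real.logb 2 (pushf μ (f i) (f i ω))) := by
    intro i
    have hconst : -Real.logb 2 (n : ℝ) = ∑ ω, μ ω * -Real.logb 2 (n : ℝ) := by
      rw [← Finset.sum_mul, hμ.2, one_mul]
    rw [hconst]
    simp only [expect, ← Finset.sum_add_distrib]
    refine Finset.sum_congr rfl fun ω _ => ?_
    rcases (hμ.1 ω).eq_or_lt with h0 | h0
    · simp [← h0]
    · rw [Real.logb_mul (by positivity) (h0.trans_le (le_pushf_apply hμ.1 (f i) ω)).ne',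
        one_div, Real.logb_inv]
      ring
  simp only [h, Finset.sum_add_distrib, Finset.sum_neg_distrib, Finset.sum_const,
    Finset.card_univ, Fintype.card_fin, nsmul_eq_mul]
  field_simp
  ring

theorem condH_timeShare {Ω α β : Type} [Fintype Ω] [Fintype α] [Fintype β] {μ : Ω → ℝ}
    (hμ : IsPMF μ) {n : ℕ} (hn : 0 < n) (f : Fin n → Ω → α) (g : Fin n → Ω → β) :
    condH (timeShare n μ) (fun t => f t.1 t.2) (fun t => (t.1, g t.1 t.2))
      = (1 / (n : ℝ)) * ∑ i, condH μ (f i) (g i) := by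
  rw [condH, Hof_congr _ (f := fun t : Fin n × Ω => (f t.1 t.2, t.1, g t.1 t.2))
    (g := fun t => (t.1, (fun i ω => (f i ω, g i ω)) t.1 t.2))
    (by intro t t'; simp only [Prod.mk.injEq]; tauto),
    Hof_timeShare hμ hn (fun i ω => (f i ω, g i ω)), Hof_timeShare hμ hn g]
  simp only [condH, Finset.sum_sub_distrib]
  ring

/-! ### The single-letter test channel induced by a code -/

/-- The index produced by the encoder from the source realization. -/
def codeIndex {Xr Xh Z : Type} {n M : ℕ} (FE : (Fin n → Xr × Xh) → Fin M)
    (y : Fin n → Xr × Xh × Z) : Fin M :=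
  FE (fun i => ((y i).1, (y i).2.1))

/-- The auxiliary variable: a time index, the codeword index, and the side information with the
letter at the time index erased (replaced by `z₀`). -/
def auxVar {Xr Xh Z : Type} {n M : ℕ} (FE : (Fin n → Xr × Xh) → Fin M) (z₀ : Z)
    (t : Fin n × (Fin n → Xr × Xh × Z)) : Fin n × Fin M × (Fin n → Z) :=
  (t.1, codeIndex FE t.2, Function.update (fun j => (t.2 j).2.2) t.1 z₀)

/-- The conditional law of `auxVar` given the source letters at the time index: all other
letters are drawn afresh from `p`. -/
def auxKernel {Xr Xh Z : Type} [Fintype Xr] [Fintype Xh] [Fintype Z] (p : Xr × Xh × Z → ℝ)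
    {n M : ℕ} (FE : (Fin n → Xr × Xh) → Fin M) (z₀ : Z) (x : Xr × Xh) :
    Fin n × Fin M × (Fin n → Z) → ℝ :=
  pushf (timeShare n (iidPMF p n))
    (fun t => auxVar FE z₀ (t.1, Function.update t.2 t.1 (x.1, x.2, z₀)))

theorem auxVar_update {Xr Xh Z : Type} {n M : ℕ} (FE : (Fin n → Xr × Xh) → Fin M) (z₀ : Z)
    (i : Fin n) (y : Fin n → Xr × Xh × Z) (xr : Xr) (xh : Xh) (z z' : Z) :
    auxVar FE z₀ (i, Function.update y i (xr, xh, z))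
      = auxVar FE z₀ (i, Function.update y i (xr, xh, z')) := by
  simp only [auxVar, codeIndex, Prod.mk.injEq, true_and]
  refine ⟨congrArg FE (funext fun j => ?_), funext fun j => ?_⟩ <;>
    by_cases hj : j = i
  · subst hj; simp
  · simp [hj]
  · subst hj; simp
  · simp [hj]

theorem jointU_auxKernel {Xr Xh Z : Type} [Fintype Xr] [Fintype Xh] [Fintype Z]
    {p : Xr × Xh × Z → ℝ} (hp : IsPMF p) {n M : ℕ} (FE : (Fin n → Xr × Xh) → Fin M) (z₀ : Z) :
    jointU p (auxKernel p FE z₀)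
      = pushf (timeShare n (iidPMF p n)) (fun t => (t.2 t.1, auxVar FE z₀ t)) := by
  funext ⟨⟨xr, xh, z⟩, u⟩
  have h : ∀ i : Fin n, p (xr, xh, z) * ∑ y, iidPMF p n y *
        (if auxVar FE z₀ (i, Function.update y i (xr, xh, z)) = u then 1 else 0)
      = ∑ y, iidPMF p n y *
        (if (y i, auxVar FE z₀ (i, y)) = ((xr, xh, z), u) then 1 else 0) := by
    intro i
    rw [← sum_resample hp i (fun y =>
      if (y i, auxVar FE z₀ (i, y)) = ((xr, xh, z), u) then 1 else 0), Finset.sum_eq_single (xr, xh, z)]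
    · simp
    · intro s _ hs
      simp [hs]
    · simp
  simp only [mul_ite, mul_one, mul_zero] at h
  simp only [jointU, auxKernel, pushf, timeShare, Fintype.sum_prod_type,
    auxVar_update FE z₀ _ _ xr xh z₀ z, ← mul_ite_zero, ← Finset.mul_sum, ← h]
  ring

theorem condH_auxVar {Xr Xh Z α : Type} [Fintype Xr] [Fintype Xh] [Fintype Z] [Fintype α]
    {p : Xr × Xh × Z → ℝ} (hp : IsPMF p) {n M : ℕ} (hn : 0 < n)
    (FE : (Fin n → Xr × Xh) → Fin M) (z₀ : Z) (f : Xr × Xh × Z → α) :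
    (1 / (n : ℝ)) * condH (iidPMF p n) (fun y i => f (y i))
        (fun y => (codeIndex FE y, fun i => (y i).2.2))
      ≤ condH (jointU p (auxKernel p FE z₀)) (fun su => f su.1) (fun su => (su.2, su.1.2.2)) := by
  have hiid := iidPMF_isPMF hp n
  have hiff : ∀ t t' : Fin n × (Fin n → Xr × Xh × Z),
      (auxVar FE z₀ t, (t.2 t.1).2.2) = (auxVar FE z₀ t', (t'.2 t'.1).2.2) ↔
      (t.1, codeIndex FE t.2, fun i => (t.2 i).2.2)
        = (t'.1, codeIndex FE t'.2, fun i => (t'.2 i).2.2) := by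
    rintro ⟨i, y⟩ ⟨i', y'⟩
    simp only [auxVar, Prod.mk.injEq]
    constructor
    · rintro ⟨⟨rfl, hw, hz⟩, hzi⟩
      refine ⟨rfl, hw, funext fun j => ?_⟩
      by_cases hj : j = i
      · rw [hj, hzi]
      · simpa [hj] using congrFun hz j
    · rintro ⟨rfl, hw, hz⟩
      exact ⟨⟨rfl, hw, by rw [hz]⟩, congrFun hz i⟩
  have hcond : condH (jointU p (auxKernel p FE z₀)) (fun su => f su.1)
        (fun su => (su.2, su.1.2.2))
      = condH (timeShare n (iidPMF p n)) (fun t => f (t.2 t.1))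
        (fun t => (t.1, codeIndex FE t.2, fun i => (t.2 i).2.2)) := by
    rw [jointU_auxKernel hp, condH_pushf, condH, condH, Hof_congr _ hiff]
    congr 1
    refine Hof_congr _ fun t t' => ?_
    rw [Prod.mk.injEq, Prod.mk.injEq (f (t.2 t.1)), hiff]
  rw [hcond, condH_timeShare hiid hn (fun i y => f (y i))
    (fun _ y => (codeIndex FE y, fun i => (y i).2.2))]
  exact mul_le_mul_of_nonneg_left (condH_pi_le_sum hiid _ _) (by positivity)

theorem pushf_jointU_fst {Xr Xh Z U : Type} [Fintype Xr] [Fintype Xh] [Fintype Z] [Fintype U]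
    (p : Xr × Xh × Z → ℝ) {pu : Xr × Xh → U → ℝ} (hpu : IsKernel pu) :
    pushf (jointU p pu) (fun su => su.1) = p := by
  funext s
  simp only [pushf, jointU]
  rw [Fintype.sum_prod_type_right, Finset.sum_comm]
  simp [← Finset.mul_sum, (hpu _).2]

/-- For any joint law, `I(X; U) - I(Z; U) ≤ I(X; U | Z)`. -/
theorem mutI_sub_mutI_le {Ω α β γ : Type} [Fintype Ω] [Fintype α] [Fintype β] [Fintype γ]
    {μ : Ω → ℝ} (hμ : IsPMF μ) (X : Ω → α) (U : Ω → β) (Z : Ω → γ) :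
    mutI μ X U - mutI μ Z U ≤ condH μ X Z - condH μ X (fun ω => (U ω, Z ω)) := by
  have sub := Hof_submodular hμ U Z X
  rw [Hof_congr μ (f := fun ω => (U ω, Z ω, X ω)) (g := fun ω => (X ω, U ω, Z ω))
      (by intro ω ω'; simp only [Prod.mk.injEq]; tauto)] at sub
  have hcomm := Hof_congr μ (f := fun ω => (U ω, Z ω)) (g := fun ω => (Z ω, U ω))
    (by simp [and_comm])
  simp only [mutI, condH]
  linarith

/-- Converse (rate) part: every `(n, M)` code whose average distortion
satisfies `Δ ≤ D` and whose equivocation satisfies `Δ_p ≥ E` has rate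
`(1/n) log₂ M ≥ R(D, E)`. -/
theorem rate_ge_RDE
    {Xr Xh Z Xhat : Type} [Fintype Xr] [Fintype Xh] [Fintype Z] [Fintype Xhat]
    (p : Xr × Xh × Z → ℝ) (hp : IsPMF p)
    (d : Xr → Xhat → ℝ) (hd : ∀ a b, 0 ≤ d a b)
    (D E : ℝ) (hD : 0 ≤ D) (hE : 0 ≤ E) (n M : ℕ) (hn : 0 < n) (hM : 0 < M)
    (FE : (Fin n → Xr × Xh) → Fin M) (FD : Fin M × (Fin n → Z) → Fin n → Xhat)
    (hΔ : avgDist p d FE FD ≤ D) (hΔp : equivoc p FE FD ≥ E) :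
    (1 / (n : ℝ)) * Real.logb 2 (M : ℝ) ≥ RDE p d D E := by
  have hn' : (0 : ℝ) < n := by positivity
  by_cases hbdd : BddBelow (RDESet p d D E)
  swap
  · rw [RDE, Real.sInf_of_not_bddBelow hbdd]
    exact mul_nonneg (by positivity)
      (Real.logb_nonneg (by norm_num) (by exact_mod_cast hM))
  have hne : Nonempty (Xr × Xh × Z) := by
    by_contra hcon
    have := not_nonempty_iff.1 hcon
    simpa using hp.2
  obtain ⟨_, _, z₀⟩ := hne
  have hiid := iidPMF_isPMF hp n
  have hν := timeShare_isPMF hiid hn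
  have hJ : IsPMF (jointU p (auxKernel p FE z₀)) := by
    rw [jointU_auxKernel hp]
    exact hν.pushf _
  have hker : IsKernel (auxKernel p FE z₀) := fun x => hν.pushf _
  refine (csInf_le hbdd ⟨Fin n × Fin M × (Fin n → Z), inferInstance, auxKernel p FE z₀,
    fun uz => FD (uz.1.2.1, Function.update uz.1.2.2 uz.1.1 uz.2) uz.1.1,
    hker, ?_, ?_, rfl⟩).trans ?_
  · refine le_of_eq_of_le ?_ hΔ
    rw [jointU_auxKernel hp, expect_pushf, expect_timeShare, avgDist]
    congr 1
    simp only [expect, Finset.mul_sum]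
    rw [Finset.sum_comm]
    refine Finset.sum_congr rfl fun y _ => Finset.sum_congr rfl fun i _ => ?_
    simp only [auxVar, Function.update_idem, recon, codeIndex]
    rw [Function.update_eq_self i (fun j => (y j).2.2)]
  · exact le_trans hΔp (condH_auxVar hp hn FE z₀ (fun s => s.2.1))
  · have hobj := mutI_sub_mutI_le hJ (fun su => (su.1.1, su.1.2.1)) (fun su => su.2)
      (fun su => su.1.2.2)
    have haux := condH_auxVar hp hn FE z₀ (fun s => (s.1, s.2.1))
    have hmarg := pushf_jointU_fst p hker
    have hsource : condH (jointU p (auxKernel p FE z₀)) (fun su => (su.1.1, su.1.2.1))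
        (fun su => su.1.2.2) = ent p - ent (pushf p (fun s => s.2.2)) := by
      have h1 := condH_pushf (jointU p (auxKernel p FE z₀)) (fun su => su.1)
        (fun s => (s.1, s.2.1)) (fun s => s.2.2)
      rw [← h1, hmarg, condH, Hof_congr p (g := fun s => s)
        (by rintro ⟨_, _, _⟩ ⟨_, _, _⟩; simp [and_assoc]), Hof, pushf_id, Hof]
    have hcode : condH (iidPMF p n) (fun y i => ((y i).1, (y i).2.1))
        (fun y => (codeIndex FE y, fun i => (y i).2.2))
        = n * ent p - n * ent (pushf p (fun s => s.2.2))
          - condH (iidPMF p n) (codeIndex FE) (fun y i => (y i).2.2) := by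
      have hz : Hof (iidPMF p n) (fun y i => (y i).2.2) = n * ent (pushf p (fun s => s.2.2)) := by
        rw [Hof, pushf_iidPMF p (fun s => s.2.2), ent_iidPMF (hp.pushf _)]
      rw [condH, condH, hz, Hof_congr (iidPMF p n) (g := fun y => y) ?_, Hof, pushf_id,
        ent_iidPMF hp]
      · ring
      · intro y y'
        refine ⟨fun h => ?_, fun h => by rw [h]⟩
        simp only [Prod.mk.injEq, funext_iff] at h
        exact funext fun i => Prod.ext (h.1 i).1 (Prod.ext (h.1 i).2 (h.2.2 i))
    have hlog := condH_le_logb_card hiid (codeIndex FE)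
      (fun (y : Fin n → Xr × Xh × Z) i => (y i).2.2)
    rw [Fintype.card_fin] at hlog
    have hscale := mul_le_mul_of_nonneg_left hlog (show 0 ≤ 1 / (n : ℝ) by positivity)
    rw [hcode] at haux
    have hexp : 1 / (n : ℝ) * (n * ent p - n * ent (pushf p (fun s => s.2.2))
          - condH (iidPMF p n) (codeIndex FE) (fun y i => (y i).2.2))
        = ent p - ent (pushf p (fun s => s.2.2))
          - 1 / (n : ℝ) * condH (iidPMF p n) (codeIndex FE) (fun y i => (y i).2.2) := by
      field_simp
    linarith
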